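/- arXiv:1201.2035 — 2 statements merged into one kernel-verified Lean document; each statement's English description precedes it below -/
import Mathlib

section
/- Let ρ > 0 and F_c > 0. For every absolutely continuous input u : [0,∞) → ℝ and every y₀ ∈ (−F_c,F_c), the Dahl output y satisfies y(t) ∈ (−F_c,F_c) for all t ≥ 0; i.e. the set (−F_c,F_c) × ℝ contains all relations {(y(t),u(t)) : t ≥ 0} of the Dahl operator. -/
open MeasureTheory Set Filter intervalIntegral

noncomputable section

/-- `u : [0,∞) → ℝ` is absolutely continuous with a.e. derivative `u'`. -/
def IsAbsCont (u u' : ℝ → ℝ) : Prop :=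
  MeasureTheory.LocallyIntegrableOn u' (Set.Ici 0) ∧
    ∀ t : ℝ, 0 ≤ t → u t = u 0 + ∫ s in (0:ℝ)..t, u' s

/-- `y` is the output of the Dahl operator (`r = 1`) with parameters `ρ, F_c`,
input `u` (a.e. derivative `u'`) and initial value `y₀`, in integrated form. -/
def IsDahlSol (ρ Fc : ℝ) (u u' y : ℝ → ℝ) (y₀ : ℝ) : Prop :=
  y 0 = y₀ ∧
    ∀ t : ℝ, 0 ≤ t →
      y t = y₀ + ∫ s in (0:ℝ)..t,
        (ρ * (1 - y s / Fc) * max 0 (u' s) + ρ * (1 + y s / Fc) * min 0 (u' s))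

/-- The input-output pair `(u, y)` (with `u̇ = u'` a.e.) is clockwise. -/
def Clockwise (u' y : ℝ → ℝ) : Prop :=
  ⊥ < Filter.liminf
      (fun T : ℝ => ((∫ t in (0:ℝ)..T, y t * u' t : ℝ) : EReal)) Filter.atTop

/-- The closed-form storage function of the Dahl model with `r = 1`. -/
def HD (ρ Fc σ : ℝ) : ℝ :=
  if 0 ≤ σ then Fc ^ 2 / ρ * Real.log (Fc / (σ + Fc)) + Fc / ρ * σ
  else Fc ^ 2 / ρ * Real.log (Fc / (Fc - σ)) - Fc / ρ * σ

open scoped Topology in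
/-- A backward integral Grönwall inequality with zero terminal data: a nonnegative function
dominated by `∫ r in s..T, c r * z r` cannot stay positive before `T`. -/
theorem exists_nonpos_of_le_integral_mul {T : ℝ} (hT : 0 < T) {c z : ℝ → ℝ}
    (hc : IntervalIntegrable c volume 0 T) (hc0 : ∀ s, 0 ≤ c s)
    (hz : ContinuousOn z (Icc 0 T))
    (h : ∀ s ∈ Icc 0 T, z s ≤ ∫ r in s..T, c r * z r) :
    ∃ a ∈ Ico 0 T, z a ≤ 0 := by
  have hprim : ContinuousOn (fun s => ∫ r in s..T, c r) (uIcc 0 T) :=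
    continuousOn_primitive_interval_left (by
      rw [uIcc_of_le hT.le]
      exact (intervalIntegrable_iff_integrableOn_Icc_of_le hT.le).1 hc)
  rw [uIcc_of_le hT.le] at hprim
  have hsmall : ∀ᶠ s in 𝓝[Icc 0 T] T, ∫ r in s..T, c r < 1 / 2 := by
    refine (hprim T (right_mem_Icc.2 hT.le)).eventually_lt_const ?_
    simp
  obtain ⟨a, ⟨ha0, haT⟩, ha⟩ : ∃ a ∈ Ico 0 T, ∫ r in a..T, c r < 1 / 2 := by
    have h1 : ∀ᶠ s in 𝓝[<] T, ∫ r in s..T, c r < 1 / 2 := by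
      rw [← nhdsWithin_Ico_eq_nhdsLT hT]
      exact hsmall.filter_mono (nhdsWithin_mono _ Ico_subset_Icc_self)
    have h2 : ∀ᶠ s in 𝓝[<] T, s ∈ Ico 0 T := Ico_mem_nhdsLT hT
    obtain ⟨a, h3, h4⟩ := (h2.and h1).exists
    exact ⟨a, h3, h4⟩
  by_contra! hpos
  have hsub : Icc a T ⊆ Icc 0 T := Icc_subset_Icc_left ha0
  obtain ⟨m, hm, hmax⟩ := isCompact_Icc.exists_isMaxOn (nonempty_Icc.2 haT.le) (hz.mono hsub)
  have hzm : 0 < z m := (hpos a ⟨ha0, haT⟩).trans_le (hmax (left_mem_Icc.2 haT.le))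
  have hcI : ∀ s ∈ Icc 0 T, IntervalIntegrable c volume s T := fun s hs =>
    hc.mono_set (by rw [uIcc_of_le hs.2, uIcc_of_le hT.le]; exact Icc_subset_Icc_left hs.1)
  have hle : ∫ r in m..T, c r * z r ≤ ∫ r in m..T, c r * z m := by
    refine integral_mono_on hm.2 ((hcI m (hsub hm)).mul_continuousOn (hz.mono ?_))
      ((hcI m (hsub hm)).mul_const _) fun r hr =>
        mul_le_mul_of_nonneg_left (hmax ⟨hm.1.trans hr.1, hr.2⟩) (hc0 r)
    rw [uIcc_of_le hm.2]
    exact Icc_subset_Icc_left (hsub hm).1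
  have hcm : ∫ r in m..T, c r ≤ ∫ r in a..T, c r :=
    integral_mono_interval hm.1 hm.2 le_rfl (Eventually.of_forall hc0) (hcI a ⟨ha0, haT.le⟩)
  have hfin := (h m (hsub hm)).trans hle
  rw [intervalIntegral.integral_mul_const] at hfin
  nlinarith

/-- The right-hand side of the Dahl equation. -/
def dahlRate (ρ Fc y v : ℝ) : ℝ :=
  ρ * (1 - y / Fc) * max 0 v + ρ * (1 + y / Fc) * min 0 v

theorem dahlRate_neg (ρ Fc y v : ℝ) : dahlRate ρ Fc (-y) (-v) = -dahlRate ρ Fc y v := by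
  have h1 : max 0 (-v) = -min 0 v := by rw [← neg_zero, max_neg_neg, neg_zero]
  have h2 : min 0 (-v) = -max 0 v := by rw [← neg_zero, min_neg_neg, neg_zero]
  rw [dahlRate, dahlRate, h1, h2]
  ring

theorem dahlRate_le {ρ Fc y : ℝ} (hρ : 0 < ρ) (hFc : 0 < Fc) (hy : -Fc ≤ y) (v : ℝ) :
    dahlRate ρ Fc y v ≤ ρ / Fc * max 0 v * (Fc - y) := by
  have h1 : 0 ≤ ρ * (1 + y / Fc) := by
    have : 1 + y / Fc = (Fc + y) / Fc := by field_simp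
    rw [this]
    exact mul_nonneg hρ.le (div_nonneg (by linarith) hFc.le)
  have h2 : ρ * (1 - y / Fc) * max 0 v = ρ / Fc * max 0 v * (Fc - y) := by
    field_simp
  have h3 := mul_nonpos_of_nonneg_of_nonpos h1 (min_le_left 0 v)
  rw [dahlRate, h2]
  linarith

/-- A trajectory of the Dahl equation inside `(-Fc, Fc)` does not reach `Fc` in finite time. -/
theorem dahl_ne_upper {ρ Fc T : ℝ} (hρ : 0 < ρ) (hFc : 0 < Fc) (hT : 0 < T) {v y : ℝ → ℝ}
    (hv : IntervalIntegrable v volume 0 T) (hy : ContinuousOn y (Icc 0 T))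
    (hf : IntervalIntegrable (fun s => dahlRate ρ Fc (y s) (v s)) volume 0 T)
    (hsol : ∀ s ∈ Icc 0 T, y T - y s = ∫ r in s..T, dahlRate ρ Fc (y r) (v r))
    (hin : ∀ s ∈ Ico 0 T, y s ∈ Ioo (-Fc) Fc) : y T ≠ Fc := by
  intro hyT
  have hc : IntervalIntegrable (fun s => ρ / Fc * max 0 (v s)) volume 0 T := by
    refine IntervalIntegrable.const_mul ?_ _
    refine ⟨?_, ?_⟩
    · simpa only [IntegrableOn, max_comm] using hv.1.pos_part
    · simpa only [IntegrableOn, max_comm] using hv.2.pos_part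
  have hz : ContinuousOn (fun s => Fc - y s) (Icc 0 T) := continuousOn_const.sub hy
  obtain ⟨a, ha, hza⟩ := exists_nonpos_of_le_integral_mul hT hc
    (fun s => mul_nonneg (div_pos hρ hFc).le (le_max_left _ _)) hz (by
      intro s hs
      have hsub : uIcc s T ⊆ uIcc 0 T := by
        rw [uIcc_of_le hs.2, uIcc_of_le hT.le]
        exact Icc_subset_Icc_left hs.1
      have hzs : ContinuousOn (fun s => Fc - y s) (uIcc s T) :=
        hz.mono (hsub.trans (uIcc_of_le hT.le).subset)
      change Fc - y s ≤ _
      rw [← hyT, hsol s hs, hyT]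
      refine integral_mono_on hs.2 (hf.mono_set hsub)
        ((hc.mono_set hsub).mul_continuousOn hzs) fun r hr => dahlRate_le hρ hFc ?_ _
      rcases hr.2.eq_or_lt with rfl | hrT
      · linarith
      · exact (hin r ⟨hs.1.trans hr.1, hrT⟩).1.le)
  linarith [(hin a ha).2]

/-- the set `(−F_c, F_c) × ℝ` contains all relations of the Dahl
operator: the output stays in `(−F_c, F_c)` for all time. -/
theorem dahl_output_invariant (ρ Fc : ℝ) (hρ : 0 < ρ) (hFc : 0 < Fc)
    (u u' y : ℝ → ℝ) (y₀ : ℝ)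
    (hu : IsAbsCont u u') (hy₀ : y₀ ∈ Set.Ioo (-Fc) Fc)
    (hy : IsDahlSol ρ Fc u u' y y₀) :
    ∀ t : ℝ, 0 ≤ t → y t ∈ Set.Ioo (-Fc) Fc := by
  intro t ht
  by_cases hf : IntervalIntegrable (fun s => dahlRate ρ Fc (y s) (u' s)) volume 0 t
  swap
  · rw [hy.2 t ht]
    unfold dahlRate at hf
    rwa [integral_undef hf, add_zero]
  have hsol : ∀ s, 0 ≤ s → y s = y₀ + ∫ r in (0:ℝ)..s, dahlRate ρ Fc (y r) (u' r) := hy.2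
  have hcont : ContinuousOn y (Icc 0 t) := by
    have h1 := continuousOn_primitive_interval' hf left_mem_uIcc
    rw [uIcc_of_le ht] at h1
    exact (continuousOn_const.add h1).congr fun s hs => hsol s hs.1
  by_contra hout
  obtain ⟨T, ⟨⟨hT0, hTt⟩, hTout⟩, hTmin⟩ :
      ∃ T, IsLeast (Icc 0 t ∩ (fun s => |y s|) ⁻¹' Ici Fc) T := by
    refine (isCompact_Icc.of_isClosed_subset (hcont.abs.preimage_isClosed_of_isClosed
      isClosed_Icc isClosed_Ici) inter_subset_left).exists_isLeast
      ⟨t, right_mem_Icc.2 ht, ?_⟩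
    rw [mem_Ioo, ← abs_lt] at hout
    exact not_lt.1 hout
  have hin : ∀ s ∈ Ico 0 T, y s ∈ Ioo (-Fc) Fc := by
    intro s hs
    rw [mem_Ioo, ← abs_lt]
    by_contra! hs'
    exact (hTmin ⟨⟨hs.1, hs.2.le.trans hTt⟩, hs'⟩).not_gt hs.2
  have hTpos : 0 < T := by
    refine hT0.lt_of_ne ?_
    rintro rfl
    have h1 : Fc ≤ |y 0| := hTout
    rw [hy.1] at h1
    exact h1.not_gt (abs_lt.2 hy₀)
  have hcontT : ContinuousOn y (Icc 0 T) := hcont.mono (Icc_subset_Icc_right hTt)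
  have hfs : ∀ s ∈ Icc 0 t,
      IntervalIntegrable (fun s => dahlRate ρ Fc (y s) (u' s)) volume 0 s := fun s hs =>
    hf.mono_set (by rw [uIcc_of_le hs.1, uIcc_of_le ht]; exact Icc_subset_Icc_right hs.2)
  have hfT := hfs T ⟨hT0, hTt⟩
  have hv : IntervalIntegrable u' volume 0 T :=
    (intervalIntegrable_iff_integrableOn_Icc_of_le hT0).2
      (hu.1.integrableOn_compact_subset Icc_subset_Ici_self isCompact_Icc)
  have hincr : ∀ s ∈ Icc 0 T, y T - y s = ∫ r in s..T, dahlRate ρ Fc (y r) (u' r) := by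
    intro s hs
    rw [hsol T hT0, hsol s hs.1, add_sub_add_left_eq_sub,
      integral_interval_sub_left hfT (hfs s ⟨hs.1, hs.2.trans hTt⟩)]
  have hupper : y T ≠ Fc := dahl_ne_upper hρ hFc hTpos hv hcontT hfT hincr hin
  have hlower : -y T ≠ Fc := by
    refine dahl_ne_upper (v := fun s => -u' s) (y := fun s => -y s) hρ hFc hTpos hv.neg
      hcontT.neg ?_ ?_ ?_
    · simp only [dahlRate_neg]
      exact hfT.neg
    · intro s hs
      simp only [dahlRate_neg, intervalIntegral.integral_neg, ← hincr s hs]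
      ring
    · intro s hs
      exact ⟨neg_lt_neg (hin s hs).2, neg_lt.1 (hin s hs).1⟩
  have hle : |y T| ≤ Fc := by
    refine ContinuousWithinAt.closure_le (s := Ico 0 T) (f := fun s => |y s|)
      (g := fun _ => Fc) ?_ ((hcontT.abs T (right_mem_Icc.2 hT0)).mono Ico_subset_Icc_self)
      continuousWithinAt_const fun s hs => (abs_lt.2 (hin s hs)).le
    rw [closure_Ico hTpos.ne]
    exact right_mem_Icc.2 hT0
  have habs : |y T| = Fc := le_antisymm hle hTout
  rcases abs_choice (y T) with h | h
  · exact hupper (h ▸ habs)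
  · exact hlower (h ▸ habs)
end
end

section
/- Let m, d, k, ρ, F_c > 0 and let (x₁,x₂,x₃) : [0,∞) → ℝ³ be a solution of the mass–spring–damper system with Dahl friction with x₃(0) ∈ (−F_c,F_c). Then x₃(t) ∈ (−F_c,F_c) for all t ≥ 0, and the function V(t) := (1/2)k x₁(t)² + (1/2)m x₂(t)² + H_D(x₃(t)) satisfies V̇(t) ≤ −d·x₂(t)² for almost every t ≥ 0. -/
open MeasureTheory Set Filter intervalIntegral

noncomputable section

/-- `(x₁,x₂,x₃)` is a solution on `[0,∞)` of the mass-spring-damper system with Dahl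
friction: `ẋ₁ = x₂`, `ẋ₂ = −(k/m)x₁ − (d/m)x₂ − (1/m)x₃`,
`ẋ₃ = ρ(1 − x₃/F_c) max{0,x₂} + ρ(1 + x₃/F_c) min{0,x₂}`. -/
def IsMSDDahlSol (m d k ρ Fc : ℝ) (x₁ x₂ x₃ : ℝ → ℝ) : Prop :=
  ∀ t : ℝ, 0 ≤ t →
    HasDerivWithinAt x₁ (x₂ t) (Set.Ici 0) t ∧
    HasDerivWithinAt x₂ (-(k / m) * x₁ t - (d / m) * x₂ t - (1 / m) * x₃ t)
      (Set.Ici 0) t ∧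
    HasDerivWithinAt x₃
      (ρ * (1 - x₃ t / Fc) * max 0 (x₂ t) + ρ * (1 + x₃ t / Fc) * min 0 (x₂ t))
      (Set.Ici 0) t

/-- A function satisfying `-g u ≤ u'` on `[0,∞)` with `g` continuous stays positive if it starts
positive. -/
theorem pos_of_neg_mul_le_deriv {u u' g : ℝ → ℝ} (hg : ContinuousOn g (Ici 0))
    (hu : ∀ t, 0 ≤ t → HasDerivWithinAt u (u' t) (Ici 0) t)
    (hle : ∀ t, 0 ≤ t → -(g t * u t) ≤ u' t) (h0 : 0 < u 0) {t : ℝ} (ht : 0 ≤ t) :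
    0 < u t := by
  have hG : Continuous fun s => g (max s 0) :=
    hg.comp_continuous (by fun_prop) fun s => le_max_right s 0
  set A : ℝ → ℝ := fun t => ∫ s in (0 : ℝ)..t, g (max s 0)
  have hA (s : ℝ) (hs : 0 ≤ s) : HasDerivAt A (g s) s := by
    simpa [max_eq_left hs] using hG.integral_hasStrictDerivAt 0 s |>.hasDerivAt
  have hP (s : ℝ) (hs : 0 ≤ s) : HasDerivWithinAt (fun s => u s * Real.exp (A s))
      (u' s * Real.exp (A s) + u s * (Real.exp (A s) * g s)) (Ici 0) s :=
    (hu s hs).mul (hA s hs).exp.hasDerivWithinAt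
  have hmono : MonotoneOn (fun s => u s * Real.exp (A s)) (Ici 0) := by
    refine monotoneOn_of_hasDerivWithinAt_nonneg (convex_Ici 0)
      (fun s hs => (hP s hs).continuousWithinAt)
      (fun s hs => (hP s (interior_subset hs)).mono interior_subset) fun s hs => ?_
    nlinarith [hle s (interior_subset hs), Real.exp_pos (A s)]
  have h : u 0 * Real.exp (A 0) ≤ u t * Real.exp (A t) := hmono self_mem_Ici ht ht
  exact pos_of_mul_pos_left ((mul_pos h0 (Real.exp_pos _)).trans_le h) (Real.exp_pos _).le

theorem hasDerivAt_HD {ρ Fc σ : ℝ} (hFc : 0 < Fc) :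
    HasDerivAt (HD ρ Fc) (Fc / ρ * (σ / (|σ| + Fc))) σ := by
  have key (σ : ℝ) (hσ : 0 ≤ σ) :
      HasDerivAt (fun s => Fc ^ 2 / ρ * Real.log (Fc / (s + Fc)) + Fc / ρ * s)
        (Fc / ρ * (σ / (σ + Fc))) σ := by
    have hpos : 0 < σ + Fc := by positivity
    have h := (((((hasDerivAt_id σ).add_const Fc).fun_inv hpos.ne').const_mul Fc).log
      (by simp only [id]; positivity)).const_mul (Fc ^ 2 / ρ) |>.add
      ((hasDerivAt_id σ).const_mul (Fc / ρ))
    simp only [← div_eq_mul_inv, id] at h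
    refine h.congr_deriv ?_
    rcases eq_or_ne ρ 0 with rfl | hρ
    · simp
    · field_simp
      ring
  have hR (hσ : 0 ≤ σ) : HasDerivWithinAt (HD ρ Fc) (Fc / ρ * (σ / (|σ| + Fc))) (Ici 0) σ := by
    rw [abs_of_nonneg hσ]
    exact (key σ hσ).hasDerivWithinAt.congr (fun s hs => if_pos hs) (if_pos hσ)
  have hL (hσ : σ ≤ 0) : HasDerivWithinAt (HD ρ Fc) (Fc / ρ * (σ / (|σ| + Fc))) (Iic 0) σ := by
    have heq (s : ℝ) (hs : s ≤ 0) :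
        HD ρ Fc s = Fc ^ 2 / ρ * Real.log (Fc / (-s + Fc)) + Fc / ρ * -s := by
      rcases hs.eq_or_lt with rfl | hs
      · simp [HD]
      · rw [HD, if_neg hs.not_ge, neg_add_eq_sub]
        ring
    have h := (key (-σ) (neg_nonneg.2 hσ)).comp σ (hasDerivAt_neg σ)
    rw [abs_of_nonpos hσ]
    refine HasDerivWithinAt.congr (h.congr_deriv ?_).hasDerivWithinAt heq (heq σ hσ)
    ring
  rcases lt_trichotomy σ 0 with h | rfl | h
  · exact (hL h.le).hasDerivAt (Iic_mem_nhds h)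
  · simpa [Ici_union_Iic] using (hR le_rfl).union (hL le_rfl)
  · exact (hR h.le).hasDerivAt (Ici_mem_nhds h)

/-- Dissipation inequality of the Dahl model: the stored energy grows at most at the rate of the
supplied power. -/
theorem dahl_dissipation {ρ Fc σ v : ℝ} (hρ : 0 < ρ) (hσ : σ ∈ Ioo (-Fc) Fc) :
    Fc / ρ * (σ / (|σ| + Fc)) *
      (ρ * (1 - σ / Fc) * max 0 v + ρ * (1 + σ / Fc) * min 0 v) ≤ σ * v := by
  obtain ⟨h1, h2⟩ := hσ
  have hFc : 0 < Fc := by linarith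
  have hpos : 0 < |σ| + Fc := by positivity
  have hrw : Fc / ρ * (σ / (|σ| + Fc)) *
      (ρ * (1 - σ / Fc) * max 0 v + ρ * (1 + σ / Fc) * min 0 v) =
      σ * ((Fc - σ) * max 0 v + (Fc + σ) * min 0 v) / (|σ| + Fc) := by
    field_simp
  rw [hrw, div_le_iff₀ hpos]
  rcases le_total 0 σ with hs | hs <;> rcases le_total 0 v with hv | hv <;>
    simp only [abs_of_nonneg, abs_of_nonpos, max_eq_right, max_eq_left, min_eq_left,
      min_eq_right, hs, hv] <;>
    nlinarith [mul_le_mul_of_nonneg_left hv (sq_nonneg σ)]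

theorem IsMSDDahlSol.mem_Ioo {m d k ρ Fc : ℝ} {x₁ x₂ x₃ : ℝ → ℝ}
    (hsol : IsMSDDahlSol m d k ρ Fc x₁ x₂ x₃) (hρ : 0 < ρ) (hFc : 0 < Fc)
    (hx₃0 : x₃ 0 ∈ Ioo (-Fc) Fc) {t : ℝ} (ht : 0 ≤ t) : x₃ t ∈ Ioo (-Fc) Fc := by
  have hg : ContinuousOn (fun s => ρ / Fc * |x₂ s|) (Ici 0) :=
    continuousOn_const.mul
      (ContinuousOn.abs fun s hs => (hsol s hs).2.1.continuousWithinAt)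
  constructor
  · have := pos_of_neg_mul_le_deriv hg (fun s hs => (hsol s hs).2.2.const_add Fc)
      (fun s _ => ?_) (by linarith [hx₃0.1]) ht
    · linarith
    · rcases le_total 0 (x₂ s) with hv | hv
      · simp only [abs_of_nonneg, max_eq_right, min_eq_left, hv]
        have : 0 ≤ ρ * x₂ s := by positivity
        field_simp
        nlinarith
      · simp only [abs_of_nonpos, max_eq_left, min_eq_right, hv]
        apply le_of_eq
        field_simp
        ring
  · have := pos_of_neg_mul_le_deriv hg (fun s hs => (hsol s hs).2.2.const_sub Fc)
      (fun s _ => ?_) (by linarith [hx₃0.2]) ht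
    · linarith
    · rcases le_total 0 (x₂ s) with hv | hv
      · simp only [abs_of_nonneg, max_eq_right, min_eq_left, hv]
        apply le_of_eq
        field_simp
        ring
      · simp only [abs_of_nonpos, max_eq_left, min_eq_right, hv]
        have : ρ * x₂ s ≤ 0 := mul_nonpos_of_nonneg_of_nonpos hρ.le hv
        field_simp
        nlinarith

/-- for the mass-spring-damper system with Dahl friction, `x₃` stays in
`(−F_c,F_c)` and the Lyapunov function `V = ½kx₁² + ½mx₂² + H_D(x₃)` satisfies
`V̇ ≤ −d x₂²` for almost every `t ≥ 0`. -/
theorem msd_dahl_lyapunov (m d k ρ Fc : ℝ)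
    (hm : 0 < m) (hd : 0 < d) (hk : 0 < k) (hρ : 0 < ρ) (hFc : 0 < Fc)
    (x₁ x₂ x₃ : ℝ → ℝ)
    (hsol : IsMSDDahlSol m d k ρ Fc x₁ x₂ x₃)
    (hx₃0 : x₃ 0 ∈ Set.Ioo (-Fc) Fc) :
    (∀ t : ℝ, 0 ≤ t → x₃ t ∈ Set.Ioo (-Fc) Fc) ∧
    ∀ᵐ t : ℝ, 0 ≤ t → ∃ D : ℝ,
      HasDerivWithinAt
        (fun s => 1 / 2 * k * (x₁ s) ^ 2 + 1 / 2 * m * (x₂ s) ^ 2 + HD ρ Fc (x₃ s))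
        D (Set.Ici 0) t ∧
      D ≤ -d * (x₂ t) ^ 2 := by
  refine ⟨fun t ht => hsol.mem_Ioo hρ hFc hx₃0 ht, Eventually.of_forall fun t ht => ?_⟩
  obtain ⟨h1, h2, h3⟩ := hsol t ht
  refine ⟨_, (((h1.pow 2).const_mul (1 / 2 * k)).add
    ((h2.pow 2).const_mul (1 / 2 * m))).add ((hasDerivAt_HD hFc).comp_hasDerivWithinAt t h3), ?_⟩
  have hdiss := dahl_dissipation (v := x₂ t) hρ (hsol.mem_Ioo hρ hFc hx₃0 ht)
  have hmech : 1 / 2 * k * (2 * x₁ t * x₂ t) +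
      1 / 2 * m * (2 * x₂ t * (-(k / m) * x₁ t - (d / m) * x₂ t - (1 / m) * x₃ t)) =
      -d * x₂ t ^ 2 - x₃ t * x₂ t := by
    field_simp
    ring
  norm_num at hdiss hmech ⊢
  linarith
end
end
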